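/- arXiv:2410.12643 — 2 statements merged into one kernel-verified Lean document; each statement's English description precedes it below -/
import Mathlib

section
/- For all positive integers i > j and every f ∈ P, one has T_i(T_j f) = T_j(T_{i+1} f). -/
/-!
Statement 0. Let `P = ℤ[x₁, x₂, …]` be the polynomial ring in countably many variables
indexed by the positive integers.  `Rop i` is the Bergeron–Sottile map
`f(x₁,x₂,…) ↦ f(x₁,…,x_{i−1},0,x_i,x_{i+1},…)`, and the quasisymmetric divided difference
`T i` is the unique ℤ-linear map with `x_i · (T i f) = R_{i+1} f − R_i f`; we quantify over
all `T` satisfying this defining property.  The claim: for `i > j`,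
`T_i (T_j f) = T_j (T_{i+1} f)`.
-/

/-- The polynomial ring `ℤ[x₁, x₂, …]` with variables indexed by the positive integers. -/
abbrev PolyP : Type := MvPolynomial ℕ+ ℤ

/-- The Bergeron–Sottile map `R_i : P → P`,
`f(x₁, x₂, …) ↦ f(x₁, …, x_{i−1}, 0, x_i, x_{i+1}, …)`. -/
noncomputable def Rop (i : ℕ+) : PolyP →ₐ[ℤ] PolyP :=
  MvPolynomial.aeval (fun j : ℕ+ =>
    if j < i then MvPolynomial.X j
    else if j = i then 0
    else MvPolynomial.X (j - 1))

theorem Rop_X_of_lt {i k : ℕ+} (h : k < i) :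
    Rop i (MvPolynomial.X k) = MvPolynomial.X k := by
  simp [Rop, h]

theorem Rop_X_self (i : ℕ+) : Rop i (MvPolynomial.X i) = 0 := by
  simp [Rop]

theorem Rop_X_add_one {i k : ℕ+} (h : i ≤ k) :
    Rop i (MvPolynomial.X (k + 1)) = MvPolynomial.X k := by
  have hlt : i < k + 1 := PNat.lt_add_one_iff.mpr h
  have hsub : k + 1 - 1 = k := by
    apply PNat.eq
    simp
  simp [Rop, hlt.not_gt, hlt.ne', hsub]

theorem PNat.exists_add_one_of_lt {b k : ℕ+} (h : b < k) : ∃ m : ℕ+, b ≤ m ∧ k = m + 1 := by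
  obtain ⟨m, rfl⟩ := PNat.exists_eq_succ_of_ne_one (one_le.trans_lt h).ne'
  exact ⟨m, PNat.lt_add_one_iff.mp h, rfl⟩

theorem Rop_Rop {a b : ℕ+} (h : b ≤ a) (f : PolyP) :
    Rop a (Rop b f) = Rop b (Rop (a + 1) f) := by
  suffices (Rop a).comp (Rop b) = (Rop b).comp (Rop (a + 1)) from DFunLike.congr_fun this f
  ext1 k
  simp only [AlgHom.comp_apply]
  rcases lt_trichotomy k b with hk | rfl | hk
  · rw [Rop_X_of_lt hk, Rop_X_of_lt (hk.trans_le h),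
      Rop_X_of_lt (PNat.lt_add_one_iff.mpr (hk.le.trans h)), Rop_X_of_lt hk]
  · rw [Rop_X_self, Rop_X_of_lt (PNat.lt_add_one_iff.mpr h), Rop_X_self, map_zero]
  · obtain ⟨m, hm, rfl⟩ := PNat.exists_add_one_of_lt hk
    rw [Rop_X_add_one hm]
    rcases lt_trichotomy m a with hma | rfl | hma
    · rw [Rop_X_of_lt hma, Rop_X_of_lt (add_lt_add_left hma 1), Rop_X_add_one hm]
    · rw [Rop_X_self, Rop_X_self, map_zero]
    · obtain ⟨n, hn, rfl⟩ := PNat.exists_add_one_of_lt hma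
      rw [Rop_X_add_one hn, Rop_X_add_one (PNat.add_one_le_iff.mpr hma),
        Rop_X_add_one (h.trans hn)]

theorem stmt0 (T : ℕ+ → (PolyP →ₗ[ℤ] PolyP))
    (hT : ∀ (i : ℕ+) (f : PolyP),
      (MvPolynomial.X i : PolyP) * T i f = Rop (i + 1) f - Rop i f)
    (i j : ℕ+) (hij : i > j) (f : PolyP) :
    T i (T j f) = T j (T (i + 1) f) := by
  have hji : j < i := hij
  have hj1 : j + 1 ≤ i := PNat.add_one_le_iff.mpr hji
  have hi : i ≤ i + 1 := (PNat.lt_add_right i 1).le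
  refine mul_left_cancel₀
    (mul_ne_zero (MvPolynomial.X_ne_zero i) (MvPolynomial.X_ne_zero (R := ℤ) j)) ?_
  have left : (MvPolynomial.X i * MvPolynomial.X j : PolyP) * T i (T j f) =
      Rop (i + 1) (Rop (j + 1) f - Rop j f) - Rop i (Rop (j + 1) f - Rop j f) := by
    rw [← hT j f, map_mul, map_mul, Rop_X_of_lt hji, Rop_X_of_lt (hji.trans_le hi),
      mul_right_comm, hT]
    ring
  have right : (MvPolynomial.X i * MvPolynomial.X j : PolyP) * T j (T (i + 1) f) =
      Rop (j + 1) (Rop (i + 1 + 1) f - Rop (i + 1) f) -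
        Rop j (Rop (i + 1 + 1) f - Rop (i + 1) f) := by
    rw [← hT (i + 1) f, map_mul, map_mul, Rop_X_add_one hji.le, Rop_X_add_one hj1,
      mul_assoc, hT]
    ring
  rw [left, right]
  simp only [map_sub]
  rw [Rop_Rop (hj1.trans hi), Rop_Rop (hji.le.trans hi), Rop_Rop hj1, Rop_Rop hji.le]
  ring
end

section
/- The map that sends a sequence ((ε₁, a₁), (ε₂, a₂), …) with each ε_i ∈ {0,1}, each a_i ∈ ℕ, and all but finitely many terms equal to (0, 0), to the class in 𝕋̃ of the word h₁^{ε₁} g₁^{a₁} h₂^{ε₂} g₂^{a₂} h₃^{ε₃} g₃^{a₃} ⋯ (factors taken in increasing order of the index i) is a bijection onto 𝕋̃. In particular, every element of the augmented Thompson monoid has a unique normal form of this shape. -/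
/-!
Statement 8.  Let `W` be the free monoid on the alphabet `{g_i : i ≥ 1} ∪ {h_i : i ≥ 1}`,
and `≈` the smallest monoid congruence containing `g_i g_j ≈ g_j g_{i+1}` for `i > j`,
`g_i h_j ≈ h_j g_{i+1}` for `i ≥ j`, `h_i g_j ≈ g_j h_{i+1}` for `i > j`, and
`h_i h_j ≈ h_j h_{i+1}` for `i ≥ j`.  The augmented Thompson monoid is `𝕋̃ = W/≈`.

Claim: the map sending a sequence `((ε₁,a₁),(ε₂,a₂),…)` (each `ε_i ∈ {0,1}`, `a_i ∈ ℕ`,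
all but finitely many terms `(0,0)`) to the class of `h₁^{ε₁} g₁^{a₁} h₂^{ε₂} g₂^{a₂} ⋯`
is a bijection onto `𝕋̃`.  A sequence is modelled as a finitely supported function
`p : ℕ+ →₀ ℕ × ℕ` with `(p i).1 ≤ 1` for all `i`.
-/

/-- The alphabet `{g_i : i ≥ 1} ∪ {h_i : i ≥ 1}`. -/
inductive Letter : Type
  | g : ℕ+ → Letter
  | h : ℕ+ → Letter

/-- The free monoid on the alphabet. -/
abbrev W : Type := FreeMonoid Letter

open FreeMonoid in
/-- The defining relations of the augmented Thompson monoid. -/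
inductive thompsonRel : W → W → Prop
  | gg (i j : ℕ+) : i > j →
      thompsonRel (of (.g i) * of (.g j)) (of (.g j) * of (.g (i + 1)))
  | gh (i j : ℕ+) : i ≥ j →
      thompsonRel (of (.g i) * of (.h j)) (of (.h j) * of (.g (i + 1)))
  | hg (i j : ℕ+) : i > j →
      thompsonRel (of (.h i) * of (.g j)) (of (.g j) * of (.h (i + 1)))
  | hh (i j : ℕ+) : i ≥ j →
      thompsonRel (of (.h i) * of (.h j)) (of (.h j) * of (.h (i + 1)))

/-- The congruence `≈`: the smallest monoid congruence containing the relations. -/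
def thompsonCon : Con W := conGen thompsonRel

/-- The augmented Thompson monoid `𝕋̃ = W/≈`. -/
abbrev AugThompson : Type := thompsonCon.Quotient

/-- The word `h₁^{ε₁} g₁^{a₁} h₂^{ε₂} g₂^{a₂} ⋯ h_N^{ε_N} g_N^{a_N}` attached to a
finitely supported sequence `((ε₁,a₁),(ε₂,a₂),…)`, where `N` is any bound beyond the
support (further factors are empty; we take `N = sup of the support`). -/
def normalWord (p : ℕ+ →₀ ℕ × ℕ) : W :=
  ((List.range (p.support.sup (fun i => (i : ℕ)))).map
    (fun k =>
      (FreeMonoid.of (Letter.h k.succPNat)) ^ ((p k.succPNat).1) *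
      (FreeMonoid.of (Letter.g k.succPNat)) ^ ((p k.succPNat).2))).prod

/-! ### The generators and their relations -/

namespace AugThompson

/-- The class of `g_{k+1}`. -/
def gen (k : ℕ) : AugThompson := thompsonCon.mk' (FreeMonoid.of (Letter.g k.succPNat))

/-- The class of `h_{k+1}`. -/
def aug (k : ℕ) : AugThompson := thompsonCon.mk' (FreeMonoid.of (Letter.h k.succPNat))

theorem mk_eq_of_rel {u v : W} (h : thompsonRel u v) :
    (thompsonCon.mk' u : AugThompson) = thompsonCon.mk' v :=
  (Con.eq thompsonCon).2 (ConGen.Rel.of _ _ h)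

theorem semiconjBy_gen_gen {i j : ℕ} (h : j < i) : SemiconjBy (gen j) (gen (i + 1)) (gen i) :=
  (mk_eq_of_rel (.gg i.succPNat j.succPNat (Nat.succPNat_lt_succPNat.2 h))).symm

theorem semiconjBy_gen_aug {i j : ℕ} (h : j < i) : SemiconjBy (gen j) (aug (i + 1)) (aug i) :=
  (mk_eq_of_rel (.hg i.succPNat j.succPNat (Nat.succPNat_lt_succPNat.2 h))).symm

theorem semiconjBy_aug_gen {i j : ℕ} (h : j ≤ i) : SemiconjBy (aug j) (gen (i + 1)) (gen i) :=
  (mk_eq_of_rel (.gh i.succPNat j.succPNat (Nat.succPNat_le_succPNat.2 h))).symm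

theorem semiconjBy_aug_aug {i j : ℕ} (h : j ≤ i) : SemiconjBy (aug j) (aug (i + 1)) (aug i) :=
  (mk_eq_of_rel (.hh i.succPNat j.succPNat (Nat.succPNat_le_succPNat.2 h))).symm

/-- The class of `h_{k+1}^ε g_{k+1}^a`, where `e = (ε, a)`. -/
def block (k : ℕ) (e : ℕ × ℕ) : AugThompson := aug k ^ e.1 * gen k ^ e.2

@[simp] theorem block_zero (k : ℕ) : block k 0 = 1 := by simp [block]

theorem block_mul_gen {i j : ℕ} (h : j < i) (e : ℕ × ℕ) :
    block i e * gen j = gen j * block (i + 1) e :=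
  (((semiconjBy_gen_aug h).pow_right e.1).mul_right ((semiconjBy_gen_gen h).pow_right e.2)).symm

theorem block_mul_aug {i j : ℕ} (h : j ≤ i) (e : ℕ × ℕ) :
    block i e * aug j = aug j * block (i + 1) e :=
  (((semiconjBy_aug_aug h).pow_right e.1).mul_right ((semiconjBy_aug_gen h).pow_right e.2)).symm

/-- The product of the first `n` blocks of the sequence `s`. -/
def blockProd (n : ℕ) (s : ℕ → ℕ × ℕ) : AugThompson :=
  ((List.range n).map fun k => block k (s k)).prod

@[simp] theorem blockProd_zero (s : ℕ → ℕ × ℕ) : blockProd 0 s = 1 := rfl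

theorem blockProd_succ (n : ℕ) (s : ℕ → ℕ × ℕ) :
    blockProd (n + 1) s = blockProd n s * block n (s n) := by
  simp [blockProd, List.range_succ]

theorem blockProd_congr {n : ℕ} {s t : ℕ → ℕ × ℕ} (h : ∀ k < n, s k = t k) :
    blockProd n s = blockProd n t := by
  unfold blockProd
  congr 1
  exact List.map_congr_left fun k hk => by rw [h k (List.mem_range.1 hk)]

theorem blockProd_eq_of_le {n m : ℕ} {s : ℕ → ℕ × ℕ} (hnm : n ≤ m)
    (h : ∀ k, n ≤ k → s k = 0) : blockProd m s = blockProd n s := by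
  induction m, hnm using Nat.le_induction with
  | base => rfl
  | succ m hm ih => rw [blockProd_succ, ih, h m hm, block_zero, mul_one]

theorem mk_normalWord (p : ℕ+ →₀ ℕ × ℕ) :
    (thompsonCon.mk' (normalWord p) : AugThompson) =
      blockProd (p.support.sup fun i => (i : ℕ)) fun k => p k.succPNat := by
  rw [normalWord, map_list_prod, List.map_map]
  rfl

theorem apply_succPNat_eq_zero (p : ℕ+ →₀ ℕ × ℕ) {k : ℕ}
    (hk : (p.support.sup fun i => (i : ℕ)) ≤ k) : p k.succPNat = 0 := by
  by_contra h
  have := Finset.le_sup (f := fun i : ℕ+ => (i : ℕ)) (Finsupp.mem_support_iff.2 h)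
  simp only [Nat.succPNat_coe] at this
  omega

/-! ### Right multiplication of normal forms by a generator -/

/-- The effect on exponent sequences of right multiplication by `g_{i+1}`. -/
def insertGen (i : ℕ) (s : ℕ → ℕ × ℕ) (k : ℕ) : ℕ × ℕ :=
  if k < i then s k else if k = i then s k + (0, 1) else if k = i + 1 then 0 else s (k - 1)

/-- The effect on exponent sequences of right multiplication by `h_{i+1}`. -/
def insertAug (i : ℕ) (s : ℕ → ℕ × ℕ) (k : ℕ) : ℕ × ℕ :=
  if k < i then s k else if k = i then (1, 0) else s (k - 1)

theorem blockProd_mul_gen {n i : ℕ} (h : i < n) (s : ℕ → ℕ × ℕ) :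
    blockProd n s * gen i = blockProd (n + 1) (insertGen i s) := by
  induction n, Nat.succ_le_of_lt h using Nat.le_induction with
  | base =>
    have hlt : blockProd i (insertGen i s) = blockProd i s :=
      blockProd_congr fun k hk => by simp [insertGen, hk]
    have hi : insertGen i s i = s i + (0, 1) := by simp [insertGen]
    have hi' : insertGen i s (i + 1) = 0 := by simp [insertGen]
    simp only [Nat.succ_eq_add_one, blockProd_succ, hlt, hi, hi', block_zero, mul_one]
    simp [block, pow_succ, mul_assoc]
  | succ n hn ih =>
    have hn' : insertGen i s (n + 1) = s n := by
      simp only [insertGen]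
      rw [if_neg (by omega), if_neg (by omega), if_neg (by omega)]
      simp
    rw [blockProd_succ, mul_assoc, block_mul_gen hn, ← mul_assoc, ih hn,
      blockProd_succ (n + 1), hn']

theorem blockProd_mul_aug {n i : ℕ} (h : i ≤ n) (s : ℕ → ℕ × ℕ) :
    blockProd n s * aug i = blockProd (n + 1) (insertAug i s) := by
  induction n, h using Nat.le_induction with
  | base =>
    have hlt : blockProd i (insertAug i s) = blockProd i s :=
      blockProd_congr fun k hk => by simp [insertAug, hk]
    have hi : insertAug i s i = (1, 0) := by simp [insertAug]
    simp [blockProd_succ, hlt, hi, block]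
  | succ n hn ih =>
    have hn' : insertAug i s (n + 1) = s n := by
      simp only [insertAug]
      rw [if_neg (by omega), if_neg (by omega)]
      simp
    rw [blockProd_succ, mul_assoc, block_mul_aug hn, ← mul_assoc, ih,
      blockProd_succ (n + 1), hn']

/-- The property of having a normal form. -/
def HasNormalForm (x : AugThompson) : Prop :=
  ∃ (n : ℕ) (s : ℕ → ℕ × ℕ), (∀ k, (s k).1 ≤ 1) ∧ (∀ k, n ≤ k → s k = 0) ∧ blockProd n s = x

theorem HasNormalForm.mul_gen {x : AugThompson} (hx : HasNormalForm x) (i : ℕ) :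
    HasNormalForm (x * gen i) := by
  obtain ⟨n, s, hs, h0, rfl⟩ := hx
  refine ⟨max n (i + 1) + 1, insertGen i s, fun k => ?_, fun k hk => ?_, ?_⟩
  · have := hs k
    have := hs (k - 1)
    simp only [insertGen]
    split_ifs <;> simp_all
  · simp only [insertGen]
    rw [if_neg (by omega), if_neg (by omega), h0 (k - 1) (by omega), ite_self]
  · rw [← blockProd_mul_gen (by omega), blockProd_eq_of_le (le_max_left _ _) h0]

theorem HasNormalForm.mul_aug {x : AugThompson} (hx : HasNormalForm x) (i : ℕ) :
    HasNormalForm (x * aug i) := by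
  obtain ⟨n, s, hs, h0, rfl⟩ := hx
  refine ⟨max n i + 1, insertAug i s, fun k => ?_, fun k hk => ?_, ?_⟩
  · have := hs k
    have := hs (k - 1)
    simp only [insertAug]
    split_ifs <;> simp_all
  · simp only [insertAug]
    rw [if_neg (by omega), if_neg (by omega), h0 (k - 1) (by omega)]
  · rw [← blockProd_mul_aug (by omega), blockProd_eq_of_le (le_max_left _ _) h0]

theorem HasNormalForm.mul_mk {x : AugThompson} (hx : HasNormalForm x) (w : W) :
    HasNormalForm (x * thompsonCon.mk' w) := by
  induction w using FreeMonoid.inductionOn' generalizing x with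
  | one => simpa using hx
  | of_mul l w ih =>
    rw [map_mul, ← mul_assoc]
    refine ih ?_
    cases l with
    | g i => simpa [gen] using hx.mul_gen i.natPred
    | h i => simpa [aug] using hx.mul_aug i.natPred

theorem hasNormalForm (x : AugThompson) : HasNormalForm x := by
  obtain ⟨w, rfl⟩ := Con.mk'_surjective x
  have h1 : HasNormalForm 1 := ⟨0, 0, by simp, by simp, rfl⟩
  simpa using h1.mul_mk w

/-! ### The right action on exponent sequences -/

/-- The right action of a letter on exponent sequences. -/
def letterAct : Letter → Function.End (ℕ → ℕ × ℕ)
  | .g i => insertGen i.natPred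
  | .h i => insertAug i.natPred

/-- The right action of the free monoid on exponent sequences. -/
def wordAct : W →* (Function.End (ℕ → ℕ × ℕ))ᵐᵒᵖ :=
  FreeMonoid.lift fun l => MulOpposite.op (letterAct l)

theorem insertGen_insertGen {i j : ℕ} (h : j < i) (s : ℕ → ℕ × ℕ) :
    insertGen j (insertGen i s) = insertGen (i + 1) (insertGen j s) := by
  funext k
  simp only [insertGen]
  grind

theorem insertAug_insertGen {i j : ℕ} (h : j ≤ i) (s : ℕ → ℕ × ℕ) :
    insertAug j (insertGen i s) = insertGen (i + 1) (insertAug j s) := by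
  funext k
  simp only [insertAug, insertGen]
  grind

theorem insertGen_insertAug {i j : ℕ} (h : j < i) (s : ℕ → ℕ × ℕ) :
    insertGen j (insertAug i s) = insertAug (i + 1) (insertGen j s) := by
  funext k
  simp only [insertAug, insertGen]
  grind

theorem insertAug_insertAug {i j : ℕ} (h : j ≤ i) (s : ℕ → ℕ × ℕ) :
    insertAug j (insertAug i s) = insertAug (i + 1) (insertAug j s) := by
  funext k
  simp only [insertAug]
  grind

theorem natPred_succ (i : ℕ+) : (i + 1).natPred = i.natPred + 1 := by
  rw [PNat.natPred_add_one]
  rfl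

theorem wordAct_eq_of_rel {u v : W} (h : thompsonRel u v) : wordAct u = wordAct v := by
  apply MulOpposite.unop_injective
  funext s
  cases h with
  | gg i j h =>
    change insertGen j.natPred (insertGen i.natPred s) =
      insertGen (i + 1).natPred (insertGen j.natPred s)
    rw [natPred_succ]
    exact insertGen_insertGen (PNat.natPred_lt_natPred.2 h) s
  | gh i j h =>
    change insertAug j.natPred (insertGen i.natPred s) =
      insertGen (i + 1).natPred (insertAug j.natPred s)
    rw [natPred_succ]
    exact insertAug_insertGen (PNat.natPred_le_natPred.2 h) s
  | hg i j h =>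
    change insertGen j.natPred (insertAug i.natPred s) =
      insertAug (i + 1).natPred (insertGen j.natPred s)
    rw [natPred_succ]
    exact insertGen_insertAug (PNat.natPred_lt_natPred.2 h) s
  | hh i j h =>
    change insertAug j.natPred (insertAug i.natPred s) =
      insertAug (i + 1).natPred (insertAug j.natPred s)
    rw [natPred_succ]
    exact insertAug_insertAug (PNat.natPred_le_natPred.2 h) s

/-- The right action of the augmented Thompson monoid on exponent sequences. -/
def act : AugThompson →* (Function.End (ℕ → ℕ × ℕ))ᵐᵒᵖ :=
  thompsonCon.lift wordAct (Con.conGen_le.2 fun _ _ h => wordAct_eq_of_rel h)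

/-- The exponent sequence read off from an element by letting it act on the zero sequence. -/
def exponents (x : AugThompson) : ℕ → ℕ × ℕ := (act x).unop 0

theorem exponents_one : exponents 1 = 0 := by
  rw [exponents, map_one]
  rfl

theorem exponents_mul_gen (x : AugThompson) (i : ℕ) :
    exponents (x * gen i) = insertGen i (exponents x) := by
  rw [exponents, map_mul]
  rfl

theorem exponents_mul_aug (x : AugThompson) (i : ℕ) :
    exponents (x * aug i) = insertAug i (exponents x) := by
  rw [exponents, map_mul]
  rfl

theorem exponents_mul_gen_pow {x : AugThompson} {n : ℕ} (h : ∀ k, n < k → exponents x k = 0)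
    (a k : ℕ) : exponents (x * gen n ^ a) k =
      if k = n then exponents x k + (0, a) else exponents x k := by
  induction a generalizing k with
  | zero => simp
  | succ a ih =>
    rw [pow_succ, ← mul_assoc, exponents_mul_gen]
    simp only [insertGen, ih]
    rcases lt_trichotomy k n with hk | rfl | hk
    · simp [hk, hk.ne]
    · simp [add_assoc]
    · rw [if_neg (by omega), if_neg hk.ne', if_neg hk.ne', h k hk]
      split_ifs
      · rfl
      · omega
      · exact h (k - 1) (by omega)

theorem exponents_blockProd (n : ℕ) {s : ℕ → ℕ × ℕ} (hs : ∀ k, (s k).1 ≤ 1) (k : ℕ) :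
    exponents (blockProd n s) k = if k < n then s k else 0 := by
  induction n generalizing k with
  | zero => simp [exponents_one]
  | succ n ih =>
    have haug (k : ℕ) : exponents (blockProd n s * aug n ^ (s n).1) k =
        if k < n then s k else if k = n then ((s n).1, 0) else 0 := by
      rcases Nat.le_one_iff_eq_zero_or_eq_one.1 (hs n) with h | h
      · rw [h, pow_zero, mul_one, ih, Prod.mk_zero_zero, ite_self]
      · rw [h, pow_one, exponents_mul_aug]
        simp only [insertAug, ih]
        grind
    rw [blockProd_succ, block, ← mul_assoc, exponents_mul_gen_pow fun k hk => ?_]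
    · simp only [haug]
      rcases lt_trichotomy k n with h | rfl | h
      · simp [h, h.ne, h.trans (Nat.lt_succ_self n)]
      · simp
      · rw [if_neg h.ne', if_neg (by omega), if_neg h.ne', if_neg (by omega)]
    · rw [haug, if_neg (by omega), if_neg (by omega)]

theorem exponents_mk_normalWord {p : ℕ+ →₀ ℕ × ℕ} (hp : ∀ i, (p i).1 ≤ 1) (k : ℕ) :
    exponents (thompsonCon.mk' (normalWord p)) k = p k.succPNat := by
  rw [mk_normalWord, exponents_blockProd _ fun k => hp k.succPNat]
  split_ifs with h
  · rfl
  · exact (apply_succPNat_eq_zero p (not_lt.1 h)).symm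

theorem HasNormalForm.exists_normalWord {x : AugThompson} (hx : HasNormalForm x) :
    ∃ p : ℕ+ →₀ ℕ × ℕ, (∀ i, (p i).1 ≤ 1) ∧ thompsonCon.mk' (normalWord p) = x := by
  obtain ⟨n, s, hs, h0, rfl⟩ := hx
  let p : ℕ+ →₀ ℕ × ℕ := Finsupp.onFinset ((Finset.range n).image Nat.succPNat)
    (fun i => s i.natPred) fun i hi => Finset.mem_image.2 ⟨i.natPred, Finset.mem_range.2
      (not_le.1 fun h => hi (h0 _ h)), PNat.succPNat_natPred i⟩
  have hp : (fun k => p k.succPNat) = s := by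
    funext k
    simp [p]
  refine ⟨p, fun i => hs _, ?_⟩
  rw [mk_normalWord]
  set m := p.support.sup fun i => (i : ℕ)
  rw [hp, ← blockProd_eq_of_le (le_max_left m n), blockProd_eq_of_le (le_max_right m n) h0]
  intro k hk
  rw [← hp]
  exact apply_succPNat_eq_zero p hk

end AugThompson

theorem stmt8 :
    Function.Bijective
      (fun p : {p : ℕ+ →₀ ℕ × ℕ // ∀ i, (p i).1 ≤ 1} =>
        (thompsonCon.mk' (normalWord p.1) : AugThompson)) := by
  constructor
  · intro p q h
    refine Subtype.ext (Finsupp.ext fun i => ?_)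
    have hk := congrArg (fun x => AugThompson.exponents x i.natPred) h
    simpa only [AugThompson.exponents_mk_normalWord p.2, AugThompson.exponents_mk_normalWord q.2,
      PNat.succPNat_natPred] using hk
  · intro x
    obtain ⟨p, hp, rfl⟩ := (AugThompson.hasNormalForm x).exists_normalWord
    exact ⟨⟨p, hp⟩, rfl⟩
end
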